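/- arXiv:2009.12706 — 2 statements merged into one kernel-verified Lean document; each statement's English description precedes it below -/
import Mathlib

section
/- (Proposition 2.1(b), off-diagonal derivative.) Let l = (l₁, l₂, l₃) satisfy the strict triangle inequalities. Then for distinct indices i, j ∈ {1, 2, 3}, the function w ↦ a_i(w) is differentiable at w = 0 and its partial derivative with respect to w_j at w = 0 equals cot(a_k(0)) = cos(a_k(0)) / sin(a_k(0)), where k is the remaining index with {i, j, k} = {1, 2, 3}; in particular, ∂a_i/∂w_j at 0 equals ∂a_j/∂w_i at 0. -/
open Real

/-- The inner angle opposite the side of length `r` in a generalized triangle with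
side lengths `p`, `q`, `r` (law of cosines). -/
noncomputable def triAngle (p q r : ℝ) : ℝ :=
  Real.arccos ((p ^ 2 + q ^ 2 - r ^ 2) / (2 * p * q))

/-- Vertex-scaled side lengths `w*l`: `(w*l)ᵢ = e^{wⱼ+w_k} lᵢ` for `{i,j,k} = {1,2,3}`
(indices taken in `Fin 3`, cyclically). -/
noncomputable def wl (l w : Fin 3 → ℝ) (i : Fin 3) : ℝ :=
  Real.exp (w (i + 1) + w (i + 2)) * l i

/-- Weak triangle inequalities for positive side lengths (a generalized triangle). -/
def IsGenTriF (l : Fin 3 → ℝ) : Prop :=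
  (∀ i, 0 < l i) ∧ ∀ i : Fin 3, l i ≤ l (i + 1) + l (i + 2)

/-- Strict triangle inequalities for positive side lengths (a nondegenerate triangle). -/
def IsTriF (l : Fin 3 → ℝ) : Prop :=
  (∀ i, 0 < l i) ∧ ∀ i : Fin 3, l i < l (i + 1) + l (i + 2)

/-- The inner angle `aᵢ(w)` at the vertex `vᵢ` of the scaled triangle `w*l`,
i.e. the angle opposite the side of length `(w*l)ᵢ`. -/
noncomputable def angF (l : Fin 3 → ℝ) (i : Fin 3) (w : Fin 3 → ℝ) : ℝ :=
  triAngle (wl l w (i + 1)) (wl l w (i + 2)) (wl l w i)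

/-- Sixteen times the squared area of a triangle with side lengths `p`, `q`, `r`. -/
noncomputable def heron (p q r : ℝ) : ℝ :=
  (2 * p * q) ^ 2 - (p ^ 2 + q ^ 2 - r ^ 2) ^ 2

theorem heron_pos {p q r : ℝ} (hpq : r < p + q) (hqr : p < q + r) (hrp : q < r + p) :
    0 < heron p q r := by
  have h : heron p q r = (p + q - r) * (q + r - p) * (r + p - q) * (p + q + r) := by
    unfold heron; ring
  rw [h]
  have h1 : 0 < p + q - r := by linarith
  have h2 : 0 < q + r - p := by linarith
  have h3 : 0 < r + p - q := by linarith
  have h4 : 0 < p + q + r := by linarith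
  positivity

theorem one_sub_cosine_sq {p q : ℝ} (r : ℝ) (hp : 0 < p) (hq : 0 < q) :
    1 - ((p ^ 2 + q ^ 2 - r ^ 2) / (2 * p * q)) ^ 2 = heron p q r / (2 * p * q) ^ 2 := by
  unfold heron
  field_simp

theorem sqrt_one_sub_cosine_sq {p q : ℝ} (r : ℝ) (hp : 0 < p) (hq : 0 < q) :
    √(1 - ((p ^ 2 + q ^ 2 - r ^ 2) / (2 * p * q)) ^ 2) = √(heron p q r) / (2 * p * q) := by
  rw [one_sub_cosine_sq r hp hq, Real.sqrt_div' _ (sq_nonneg _), Real.sqrt_sq (by positivity)]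

theorem abs_cosine_lt_one {p q r : ℝ} (hp : 0 < p) (hq : 0 < q) (h : 0 < heron p q r) :
    |(p ^ 2 + q ^ 2 - r ^ 2) / (2 * p * q)| < 1 := by
  rw [← sq_lt_one_iff_abs_lt_one, ← sub_pos, one_sub_cosine_sq r hp hq]
  positivity

theorem triAngle_comm (p q r : ℝ) : triAngle p q r = triAngle q p r := by
  unfold triAngle
  congr 1
  ring

theorem cot_triAngle {p q r : ℝ} (hp : 0 < p) (hq : 0 < q) (h : 0 < heron p q r) :
    Real.cos (triAngle p q r) / Real.sin (triAngle p q r) =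
      (p ^ 2 + q ^ 2 - r ^ 2) / √(heron p q r) := by
  have hx := abs_lt.1 (abs_cosine_lt_one hp hq h)
  rw [triAngle, Real.cos_arccos hx.1.le hx.2.le, Real.sin_arccos, sqrt_one_sub_cosine_sq r hp hq]
  have := Real.sqrt_pos.2 h
  field_simp

theorem heron_comm (p q r : ℝ) : heron q p r = heron p q r := by
  unfold heron; ring

theorem heron_rotate (p q r : ℝ) : heron r p q = heron p q r := by
  unfold heron; ring

/-- The derivative of the angle when its opposite side and one adjacent side are scaled
by the same factor. -/
theorem hasDerivAt_triAngle_exp {p q r : ℝ} (hp : 0 < p) (hq : 0 < q) (hr : 0 < r)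
    (h : 0 < heron p q r) :
    HasDerivAt (fun t : ℝ => triAngle p (Real.exp t * q) (Real.exp t * r))
      (Real.cos (triAngle r p q) / Real.sin (triAngle r p q)) 0 := by
  have hx := abs_lt.1 (abs_cosine_lt_one hp hq h)
  have hsqrt := Real.sqrt_pos.2 h
  have hq' : HasDerivAt (fun t : ℝ => Real.exp t * q) q 0 := by
    simpa using (Real.hasDerivAt_exp 0).mul_const q
  have hr' : HasDerivAt (fun t : ℝ => Real.exp t * r) r 0 := by
    simpa using (Real.hasDerivAt_exp 0).mul_const r
  have hcos := (((hq'.pow 2).const_add (p ^ 2)).sub (hr'.pow 2)).div (hq'.const_mul (2 * p))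
    (by simp [hp.ne', hq.ne'])
  have harccos := Real.hasDerivAt_arccos hx.1.ne' hx.2.ne
  rw [sqrt_one_sub_cosine_sq r hp hq] at harccos
  rw [cot_triAngle hr hp (by rwa [heron_rotate]), heron_rotate]
  refine (HasDerivAt.comp_of_eq (0 : ℝ) harccos hcos (by simp)).congr_deriv ?_
  simp
  field_simp
  ring

theorem IsTriF.heron_pos {l : Fin 3 → ℝ} (hl : IsTriF l) (i : Fin 3) :
    0 < heron (l (i + 1)) (l (i + 2)) (l i) := by
  have h0 := hl.2 0
  have h1 := hl.2 1
  have h2 := hl.2 2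
  apply _root_.heron_pos <;> fin_cases i <;> simp at * <;> linarith

theorem wl_zero (l : Fin 3 → ℝ) : wl l 0 = l := by
  ext i
  simp [wl]

theorem wl_smul_single_self (l : Fin 3 → ℝ) (j : Fin 3) (t : ℝ) :
    wl l (t • Pi.single j 1) j = l j := by
  fin_cases j <;> simp [wl]

theorem wl_smul_single_of_ne (l : Fin 3 → ℝ) {i j : Fin 3} (h : i ≠ j) (t : ℝ) :
    wl l (t • Pi.single j 1) i = Real.exp t * l i := by
  fin_cases i <;> fin_cases j <;> simp [wl] at *

theorem differentiableAt_angF {l : Fin 3 → ℝ} (hl : IsTriF l) (i : Fin 3) :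
    DifferentiableAt ℝ (angF l i) 0 := by
  have hx := abs_lt.1 (abs_cosine_lt_one (hl.1 (i + 1)) (hl.1 (i + 2)) (hl.heron_pos i))
  have hwl (m : Fin 3) : DifferentiableAt ℝ (fun w => wl l w m) 0 := by
    unfold wl
    fun_prop
  have hp := (hl.1 (i + 1)).ne'
  have hq := (hl.1 (i + 2)).ne'
  have hcos : DifferentiableAt ℝ (fun w =>
      (wl l w (i + 1) ^ 2 + wl l w (i + 2) ^ 2 - wl l w i ^ 2) / (2 * wl l w (i + 1) * wl l w (i + 2))) 0 := by
    fun_prop (disch := simp [wl_zero, hp, hq])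
  refine DifferentiableAt.comp (g := Real.arccos) 0 ?_ hcos
  rw [wl_zero]
  exact Real.differentiableAt_arccos.2 ⟨hx.1.ne', hx.2.ne⟩

theorem angF_zero (l : Fin 3 → ℝ) (i : Fin 3) :
    angF l i 0 = triAngle (l (i + 1)) (l (i + 2)) (l i) := by
  rw [angF, wl_zero]

theorem fderiv_angF_single {l : Fin 3 → ℝ} (hl : IsTriF l) {i j k : Fin 3}
    (hij : i ≠ j) (hik : k ≠ i) (hjk : k ≠ j) :
    fderiv ℝ (angF l i) 0 (Pi.single j 1) =
      Real.cos (angF l k 0) / Real.sin (angF l k 0) := by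
  rw [← (differentiableAt_angF hl i).lineDeriv_eq_fderiv]
  refine HasDerivAt.deriv ?_
  have hpos := hl.heron_pos i
  have hcyc : ∀ i j k : Fin 3, i ≠ j → k ≠ i → k ≠ j →
      (j = i + 1 ∧ k = i + 2) ∨ (j = i + 2 ∧ k = i + 1) := by decide
  have h1 : i + 2 + 1 = i := by grind
  have h2 : i + 2 + 2 = i + 1 := by grind
  have h3 : i + 1 + 1 = i + 2 := by grind
  have h4 : i + 1 + 2 = i := by grind
  simp only [zero_add, angF_zero]
  unfold angF
  rcases hcyc i j k hij hik hjk with ⟨rfl, rfl⟩ | ⟨rfl, rfl⟩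
  · simp only [wl_smul_single_self, wl_smul_single_of_ne l hij, wl_smul_single_of_ne l hjk, h1, h2]
    exact hasDerivAt_triAngle_exp (hl.1 _) (hl.1 _) (hl.1 _) hpos
  · simp only [wl_smul_single_self, wl_smul_single_of_ne l hij, wl_smul_single_of_ne l hjk, h3, h4]
    rw [triAngle_comm (l (i + 2)) (l i)]
    simp_rw [fun t : ℝ => triAngle_comm (Real.exp t * l (i + 1)) (l (i + 2))]
    refine hasDerivAt_triAngle_exp (hl.1 _) (hl.1 _) (hl.1 _) ?_
    rwa [heron_comm]

/-- (Proposition 2.1(b), off-diagonal derivative.)  For a nondegenerate triangle `l`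
and distinct indices `i, j` with remaining index `k`, the angle functions `aᵢ` and `aⱼ`
are differentiable at `w = 0`, `∂aᵢ/∂wⱼ(0) = cot(a_k(0)) = cos(a_k(0))/sin(a_k(0))`,
and `∂aᵢ/∂wⱼ(0) = ∂aⱼ/∂wᵢ(0)`. -/
theorem angle_offdiagonal_derivative
    (l : Fin 3 → ℝ) (hl : IsTriF l) (i j k : Fin 3)
    (hij : i ≠ j) (hik : k ≠ i) (hjk : k ≠ j) :
    DifferentiableAt ℝ (angF l i) (0 : Fin 3 → ℝ) ∧
    DifferentiableAt ℝ (angF l j) (0 : Fin 3 → ℝ) ∧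
    fderiv ℝ (angF l i) (0 : Fin 3 → ℝ) (Pi.single j 1) =
      Real.cos (angF l k 0) / Real.sin (angF l k 0) ∧
    fderiv ℝ (angF l i) (0 : Fin 3 → ℝ) (Pi.single j 1) =
      fderiv ℝ (angF l j) (0 : Fin 3 → ℝ) (Pi.single i 1) := by
  exact ⟨differentiableAt_angF hl i, differentiableAt_angF hl j,
    fderiv_angF_single hl hij hik hjk,
    (fderiv_angF_single hl hij hik hjk).trans (fderiv_angF_single hl hij.symm hjk hik).symm⟩
end

section
/- (Lemma 5.7 / boundary Laplacian estimate.) Let n ≥ 2 and M > 0, and consider the n-th subdivision graph with vertex set V, corner A = (0,0) and opposite side V₀ as defined. Let η be a conductance with 1/M ≤ η(p, q) ≤ M for every pair of adjacent vertices p, q. Suppose f : V → ℝ satisfies (Δf)_p = 0 for every p ∉ {A} ∪ V₀, f(p) = 0 for every p ∈ V₀, and (Δf)_A = 1. Then for every u ∈ V₀, |(Δf)_u| ≤ 20M / √(ln n). -/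
open Real
open scoped Classical

/-- The vertex set of the `n`-th standard subdivision of an equilateral triangle:
`{(i,j) : 0 ≤ i, 0 ≤ j, i + j ≤ n}` (coordinates taken in `ℤ`). -/
def inV (n : ℕ) (p : ℤ × ℤ) : Prop :=
  0 ≤ p.1 ∧ 0 ≤ p.2 ∧ p.1 + p.2 ≤ (n : ℤ)

/-- The six potential neighbours of a vertex: differences `±(1,0), ±(0,1), ±(1,−1)`. -/
def nbrs (p : ℤ × ℤ) : Finset (ℤ × ℤ) :=
  {p + (1, 0), p + (-1, 0), p + (0, 1), p + (0, -1), p + (1, -1), p + (-1, 1)}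

/-- The Laplacian associated to a conductance `η`:
`(Δf)_p = Σ_{q ∼ p} η(p,q)·(f(p) − f(q))`, the sum being over the neighbours of `p`
inside the vertex set. -/
noncomputable def lap (n : ℕ) (η : ℤ × ℤ → ℤ × ℤ → ℝ) (f : ℤ × ℤ → ℝ) (p : ℤ × ℤ) : ℝ :=
  ∑ q ∈ (nbrs p).filter (fun q => inV n q), η p q * (f p - f q)

/-- The vertex set `{p | inV n p}` as a finite set. -/
noncomputable def vertexFinset (n : ℕ) : Finset (ℤ × ℤ) :=
  (Finset.Icc 0 (n : ℤ) ×ˢ Finset.Icc 0 (n : ℤ)).filter (fun p => inV n p)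

lemma mem_vertexFinset {n : ℕ} {p : ℤ × ℤ} : p ∈ vertexFinset n ↔ inV n p := by
  simp only [vertexFinset, Finset.mem_filter, Finset.mem_product, Finset.mem_Icc]
  constructor
  · exact fun h => h.2
  · intro h
    have h' := h
    simp only [inV] at h'
    refine ⟨⟨⟨?_, ?_⟩, ?_, ?_⟩, h⟩ <;> omega

lemma mem_nbrs {p q : ℤ × ℤ} : q ∈ nbrs p ↔
    (q.1 = p.1 + 1 ∧ q.2 = p.2) ∨ (q.1 = p.1 - 1 ∧ q.2 = p.2) ∨
    (q.1 = p.1 ∧ q.2 = p.2 + 1) ∨ (q.1 = p.1 ∧ q.2 = p.2 - 1) ∨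
    (q.1 = p.1 + 1 ∧ q.2 = p.2 - 1) ∨ (q.1 = p.1 - 1 ∧ q.2 = p.2 + 1) := by
  simp only [nbrs, Finset.mem_insert, Finset.mem_singleton, Prod.ext_iff, Prod.fst_add,
    Prod.snd_add]
  omega

lemma mem_nbrs_comm {p q : ℤ × ℤ} : q ∈ nbrs p ↔ p ∈ nbrs q := by
  rw [mem_nbrs, mem_nbrs]
  omega

/-- Twice the Dirichlet form. -/
noncomputable def dirichletForm (n : ℕ) (η : ℤ × ℤ → ℤ × ℤ → ℝ) (f g : ℤ × ℤ → ℝ) : ℝ :=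
  ∑ p ∈ vertexFinset n, ∑ q ∈ (nbrs p).filter (fun q => inV n q),
    η p q * ((f p - f q) * (g p - g q))

lemma sum_edges_comm (n : ℕ) (F : ℤ × ℤ → ℤ × ℤ → ℝ) :
    ∑ p ∈ vertexFinset n, ∑ q ∈ (nbrs p).filter (fun q => inV n q), F p q =
      ∑ p ∈ vertexFinset n, ∑ q ∈ (nbrs p).filter (fun q => inV n q), F q p := by
  apply Finset.sum_comm'
  intro p q
  simp only [mem_vertexFinset, Finset.mem_filter]
  rw [mem_nbrs_comm]
  tauto

/-- Discrete Green formula. -/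
lemma dirichletForm_eq (n : ℕ) (η : ℤ × ℤ → ℤ × ℤ → ℝ) (hsymm : ∀ p q, η p q = η q p)
    (f g : ℤ × ℤ → ℝ) :
    dirichletForm n η f g = 2 * ∑ p ∈ vertexFinset n, f p * lap n η g p := by
  have h1 : ∑ p ∈ vertexFinset n, f p * lap n η g p =
      ∑ p ∈ vertexFinset n, ∑ q ∈ (nbrs p).filter (fun q => inV n q),
        η p q * (f p * (g p - g q)) := by
    refine Finset.sum_congr rfl fun p _ => ?_
    rw [lap, Finset.mul_sum]
    exact Finset.sum_congr rfl fun q _ => by ring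
  have h2 := sum_edges_comm n (fun p q => η p q * (f p * (g p - g q)))
  rw [two_mul, h1]
  nth_rewrite 2 [h2]
  rw [dirichletForm, ← Finset.sum_add_distrib]
  refine Finset.sum_congr rfl fun p _ => ?_
  rw [← Finset.sum_add_distrib]
  refine Finset.sum_congr rfl fun q _ => ?_
  rw [hsymm q p]
  ring

lemma dirichletForm_comm (n : ℕ) (η : ℤ × ℤ → ℤ × ℤ → ℝ) (f g : ℤ × ℤ → ℝ) :
    dirichletForm n η f g = dirichletForm n η g f := by
  simp only [dirichletForm, mul_comm]

/-- Maximum principle: a function that is harmonic on the non-boundary part of `S` is dominated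
by its values at the boundary points `B` of `S`. -/
lemma exists_boundary_le {n : ℕ} {η : ℤ × ℤ → ℤ × ℤ → ℝ}
    (hpos : ∀ p q, inV n p → inV n q → q ∈ nbrs p → 0 < η p q) (g : ℤ × ℤ → ℝ)
    (S : Finset (ℤ × ℤ)) (B : ℤ × ℤ → Prop) (hSV : ∀ p ∈ S, inV n p)
    (hS : ∀ p ∈ S, ¬ B p → p.1 + p.2 ≠ (n : ℤ) ∧ lap n η g p = 0 ∧
      ∀ q ∈ nbrs p, inV n q → q ∈ S) {p : ℤ × ℤ} (hp : p ∈ S) :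
    ∃ b ∈ S, B b ∧ g p ≤ g b := by
  obtain ⟨p₀, hp₀, hmax⟩ := Finset.exists_max_image S g ⟨p, hp⟩
  obtain ⟨p₁, hp₁, hmax'⟩ := Finset.exists_max_image (S.filter fun q => g q = g p₀)
    (fun q => q.1 + q.2) ⟨p₀, by simp [hp₀]⟩
  rw [Finset.mem_filter] at hp₁
  refine ⟨p₁, hp₁.1, ?_, hp₁.2 ▸ hmax p hp⟩
  by_contra hB
  obtain ⟨hn, hlap, hnb⟩ := hS p₁ hp₁.1 hB
  have hV := hSV p₁ hp₁.1
  have hq : p₁ + (1, 0) ∈ nbrs p₁ := by simp [nbrs]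
  have hqV : inV n (p₁ + (1, 0)) := by
    simp only [inV, Prod.fst_add, Prod.snd_add] at hV ⊢
    omega
  have hnn : ∀ q ∈ (nbrs p₁).filter (fun q => inV n q), 0 ≤ η p₁ q * (g p₁ - g q) := by
    intro q hq
    rw [Finset.mem_filter] at hq
    refine mul_nonneg (hpos _ _ hV hq.2 hq.1).le ?_
    rw [hp₁.2, sub_nonneg]
    exact hmax q (hnb q hq.1 hq.2)
  have hz := (Finset.sum_eq_zero_iff_of_nonneg hnn).1 hlap (p₁ + (1, 0))
    (Finset.mem_filter.2 ⟨hq, hqV⟩)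
  have heq : g (p₁ + (1, 0)) = g p₀ := by
    rcases mul_eq_zero.1 hz with h | h
    · exact absurd h (hpos _ _ hV hqV hq).ne'
    · rw [← hp₁.2]; linarith
  have := hmax' (p₁ + (1, 0)) (Finset.mem_filter.2 ⟨hnb _ hq hqV, heq⟩)
  simp only [Prod.fst_add, Prod.snd_add] at this
  omega

/-- The maximum principle on the whole triangle, with boundary the side `i + j = n`. -/
lemma exists_side_le {n : ℕ} {η : ℤ × ℤ → ℤ × ℤ → ℝ}
    (hpos : ∀ p q, inV n p → inV n q → q ∈ nbrs p → 0 < η p q) (g : ℤ × ℤ → ℝ)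
    (hg : ∀ p, inV n p → p.1 + p.2 ≠ (n : ℤ) → lap n η g p = 0) {p : ℤ × ℤ} (hp : inV n p) :
    ∃ b, inV n b ∧ b.1 + b.2 = (n : ℤ) ∧ g p ≤ g b := by
  obtain ⟨b, hb, hb', hle⟩ := exists_boundary_le hpos g (vertexFinset n)
    (fun p => p.1 + p.2 = (n : ℤ)) (fun p hp => mem_vertexFinset.1 hp)
    (fun p hp h => ⟨h, hg p (mem_vertexFinset.1 hp) h, fun q _ hq => mem_vertexFinset.2 hq⟩)
    (mem_vertexFinset.2 hp)
  exact ⟨b, mem_vertexFinset.1 hb, hb', hle⟩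

lemma lap_neg (n : ℕ) (η : ℤ × ℤ → ℤ × ℤ → ℝ) (f : ℤ × ℤ → ℝ) (p : ℤ × ℤ) :
    lap n η (-f) p = -lap n η f p := by
  rw [lap, lap, ← Finset.sum_neg_distrib]
  exact Finset.sum_congr rfl fun q _ => by simp only [Pi.neg_apply]; ring

/-- Extension by zero of a function on the vertices. -/
noncomputable def zeroExtend (n : ℕ) (g : vertexFinset n → ℝ) (p : ℤ × ℤ) : ℝ :=
  if h : p ∈ vertexFinset n then g ⟨p, h⟩ else 0

/-- The linear operator whose inverse solves the Dirichlet problem with data on the side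
`i + j = n`. -/
noncomputable def dirichletOperator (n : ℕ) (η : ℤ × ℤ → ℤ × ℤ → ℝ) :
    (vertexFinset n → ℝ) →ₗ[ℝ] (vertexFinset n → ℝ) where
  toFun g p := if p.1.1 + p.1.2 = (n : ℤ) then g p else lap n η (zeroExtend n g) p
  map_add' g h := by
    have hadd : zeroExtend n (g + h) = zeroExtend n g + zeroExtend n h := by
      funext q
      by_cases hq : q ∈ vertexFinset n <;> simp [zeroExtend, hq]
    funext p
    by_cases hp : p.1.1 + p.1.2 = (n : ℤ)
    · simp [hp]
    · simp only [hp, if_false, Pi.add_apply, lap, hadd, ← Finset.sum_add_distrib]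
      exact Finset.sum_congr rfl fun q _ => by ring
  map_smul' c g := by
    have hsmul : zeroExtend n (c • g) = c • zeroExtend n g := by
      funext q
      by_cases hq : q ∈ vertexFinset n <;> simp [zeroExtend, hq]
    funext p
    by_cases hp : p.1.1 + p.1.2 = (n : ℤ)
    · simp [hp]
    · simp only [hp, if_false, Pi.smul_apply, smul_eq_mul, lap, hsmul, RingHom.id_apply,
        Finset.mul_sum]
      exact Finset.sum_congr rfl fun q _ => by ring

/-- Solvability of the Dirichlet problem with data on the side `i + j = n`. -/
lemma exists_harmonic_extension {n : ℕ} {η : ℤ × ℤ → ℤ × ℤ → ℝ}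
    (hpos : ∀ p q, inV n p → inV n q → q ∈ nbrs p → 0 < η p q) (φ : ℤ × ℤ → ℝ) :
    ∃ w : ℤ × ℤ → ℝ, (∀ p, inV n p → p.1 + p.2 = (n : ℤ) → w p = φ p) ∧
      ∀ p, inV n p → p.1 + p.2 ≠ (n : ℤ) → lap n η w p = 0 := by
  have hinj : Function.Injective (dirichletOperator n η) := by
    rw [injective_iff_map_eq_zero]
    intro g hg
    have hside : ∀ p, inV n p → p.1 + p.2 = (n : ℤ) → zeroExtend n g p = 0 := by
      intro p hp hpn
      have h := congrFun hg ⟨p, mem_vertexFinset.2 hp⟩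
      simpa [dirichletOperator, hpn, zeroExtend, mem_vertexFinset.2 hp] using h
    have hlap : ∀ p, inV n p → p.1 + p.2 ≠ (n : ℤ) → lap n η (zeroExtend n g) p = 0 := by
      intro p hp hpn
      have h := congrFun hg ⟨p, mem_vertexFinset.2 hp⟩
      simpa [dirichletOperator, hpn] using h
    funext p
    have hp := mem_vertexFinset.1 p.2
    obtain ⟨b, hb, hbn, hle⟩ := exists_side_le hpos _ hlap hp
    obtain ⟨b', hb', hbn', hle'⟩ := exists_side_le hpos (-zeroExtend n g)
      (fun p hp hpn => by rw [lap_neg, hlap p hp hpn, neg_zero]) hp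
    have hgp : zeroExtend n g p.1 = g p := by simp [zeroExtend]
    rw [hside b hb hbn, hgp] at hle
    rw [Pi.neg_apply, Pi.neg_apply, hside b' hb' hbn', hgp] at hle'
    simp only [Pi.zero_apply]
    linarith
  obtain ⟨g, hg⟩ := LinearMap.injective_iff_surjective.1 hinj
    (fun p => if p.1.1 + p.1.2 = (n : ℤ) then φ p else 0)
  refine ⟨zeroExtend n g, fun p hp hpn => ?_, fun p hp hpn => ?_⟩
  · have h := congrFun hg ⟨p, mem_vertexFinset.2 hp⟩
    simpa [dirichletOperator, hpn, zeroExtend, mem_vertexFinset.2 hp] using h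
  · have h := congrFun hg ⟨p, mem_vertexFinset.2 hp⟩
    simpa [dirichletOperator, hpn] using h

/-- Energy of the edge from `p` to `p + v`, for unit conductances; zero if the edge leaves the
triangle. -/
noncomputable def edgeEnergy (n : ℕ) (w : ℤ × ℤ → ℝ) (v p : ℤ × ℤ) : ℝ :=
  if inV n (p + v) then (w p - w (p + v)) ^ 2 else 0

lemma edgeEnergy_nonneg (n : ℕ) (w : ℤ × ℤ → ℝ) (v p : ℤ × ℤ) : 0 ≤ edgeEnergy n w v p := by
  unfold edgeEnergy
  split_ifs <;> positivity

/-- Cauchy–Schwarz along a straight segment of the triangle. -/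
lemma sq_sub_le_segment {n : ℕ} (w : ℤ × ℤ → ℝ) {v : ℤ × ℤ} (hv : v ≠ 0) (p : ℤ × ℤ) (k : ℕ)
    (s : Finset (ℤ × ℤ)) (hs : ∀ i ≤ k, p + i • v ∈ s) (hsV : ∀ q ∈ s, inV n q) :
    (w p - w (p + k • v)) ^ 2 ≤ k * ∑ q ∈ s, edgeEnergy n w v q := by
  have h1 := Finset.sum_range_sub' (fun i : ℕ => w (p + i • v)) k
  simp only [zero_smul, add_zero] at h1
  rw [← h1]
  refine sq_sum_le_card_mul_sum_sq.trans ?_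
  rw [Finset.card_range]
  refine mul_le_mul_of_nonneg_left ?_ (Nat.cast_nonneg k)
  have hinj : Function.Injective (fun i : ℕ => p + i • v) := by
    intro i j hij
    have h : i • v = j • v := add_left_cancel hij
    rw [← natCast_zsmul, ← natCast_zsmul] at h
    exact_mod_cast smul_left_injective ℤ hv h
  calc ∑ i ∈ Finset.range k, (w (p + i • v) - w (p + (i + 1) • v)) ^ 2
      = ∑ i ∈ Finset.range k, edgeEnergy n w v (p + i • v) := by
        refine Finset.sum_congr rfl fun i hi => ?_
        have h := hsV _ (hs (i + 1) (Finset.mem_range.1 hi))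
        rw [succ_nsmul, ← add_assoc] at h ⊢
        rw [edgeEnergy, if_pos h]
    _ = ∑ q ∈ (Finset.range k).image (fun i : ℕ => p + i • v), edgeEnergy n w v q :=
        (Finset.sum_image hinj.injOn).symm
    _ ≤ ∑ q ∈ s, edgeEnergy n w v q := by
        refine Finset.sum_le_sum_of_subset_of_nonneg ?_ fun q _ _ => edgeEnergy_nonneg n w v q
        intro q hq
        obtain ⟨i, hi, rfl⟩ := Finset.mem_image.1 hq
        exact hs i (Finset.mem_range.1 hi).le

/-- Horizontal and vertical edges carry at most the total Dirichlet energy. -/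
lemma sum_edgeEnergy_le {n : ℕ} {M : ℝ} (hM : 0 < M) {η : ℤ × ℤ → ℤ × ℤ → ℝ}
    (hη : ∀ p q, inV n p → inV n q → q ∈ nbrs p → 1 / M ≤ η p q) (w : ℤ × ℤ → ℝ) :
    ∑ p ∈ vertexFinset n, edgeEnergy n w (0, 1) p +
      ∑ p ∈ vertexFinset n, edgeEnergy n w (1, 0) p ≤ M * dirichletForm n η w w := by
  rw [dirichletForm, Finset.mul_sum, ← Finset.sum_add_distrib]
  refine Finset.sum_le_sum fun p hp => ?_
  have hpV := mem_vertexFinset.1 hp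
  have hne : p + (0, 1) ≠ p + (1, 0) := by simp
  have hsub : ({p + (0, 1), p + (1, 0)} : Finset (ℤ × ℤ)).filter (fun q => inV n q) ⊆
      (nbrs p).filter (fun q => inV n q) := by
    refine Finset.filter_subset_filter _ ?_
    intro q hq
    simp only [Finset.mem_insert, Finset.mem_singleton] at hq
    rcases hq with rfl | rfl <;> simp [nbrs]
  calc edgeEnergy n w (0, 1) p + edgeEnergy n w (1, 0) p
      = ∑ q ∈ ({p + (0, 1), p + (1, 0)} : Finset (ℤ × ℤ)).filter (fun q => inV n q),
          (w p - w q) ^ 2 := by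
        rw [Finset.sum_filter, Finset.sum_pair hne]
        rfl
    _ ≤ ∑ q ∈ (nbrs p).filter (fun q => inV n q), (w p - w q) ^ 2 :=
        Finset.sum_le_sum_of_subset_of_nonneg hsub fun _ _ _ => sq_nonneg _
    _ ≤ _ := by
        rw [Finset.mul_sum]
        refine Finset.sum_le_sum fun q hq => ?_
        rw [Finset.mem_filter] at hq
        have h := hη p q hpV hq.2 hq.1
        rw [div_le_iff₀ hM] at h
        nlinarith [mul_le_mul_of_nonneg_right h (sq_nonneg (w p - w q))]

lemma sum_lines_le (n R : ℕ) (e : ℤ × ℤ → ℝ) (he : ∀ p, 0 ≤ e p) (x : ℤ × ℤ → ℤ) (c : ℤ) :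
    ∑ i ∈ Finset.range R, ∑ p ∈ vertexFinset n with x p = c - (i + 1 : ℕ), e p ≤
      ∑ p ∈ vertexFinset n, e p := by
  have h := Finset.sum_fiberwise_le_sum_of_sum_fiber_nonneg (s := vertexFinset n)
    (t := (Finset.range R).image fun i : ℕ => c - ((i + 1 : ℕ) : ℤ)) (g := x) (f := e)
    (fun y _ => Finset.sum_nonneg fun p _ => he p)
  rwa [Finset.sum_image (by intro i _ j _ hij; simp only at hij; omega)] at h

/-- If `w` is harmonic off the side `i + j = n` and vanishes on that side except at `u`, its value
at the corner is controlled by the energy on the two lines at distance `r` from `u`. -/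
lemma sq_corner_le {n : ℕ} {η : ℤ × ℤ → ℤ × ℤ → ℝ}
    (hpos : ∀ p q, inV n p → inV n q → q ∈ nbrs p → 0 < η p q) {w : ℤ × ℤ → ℝ} {u : ℤ × ℤ}
    (hu : inV n u) (hun : u.1 + u.2 = (n : ℤ))
    (hside : ∀ p, inV n p → p.1 + p.2 = (n : ℤ) → p ≠ u → w p = 0)
    (hharm : ∀ p, inV n p → p.1 + p.2 ≠ (n : ℤ) → lap n η w p = 0)
    (hA : 0 ≤ w (0, 0)) {r : ℕ} (hr : 1 ≤ r) (hrn : 2 * r ≤ n) :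
    w (0, 0) ^ 2 ≤ 2 * r *
      (∑ p ∈ vertexFinset n with p.1 = u.1 - (r : ℕ), edgeEnergy n w (0, 1) p +
        ∑ p ∈ vertexFinset n with p.2 = u.2 - (r : ℕ), edgeEnergy n w (1, 0) p) := by
  set E₁ := ∑ p ∈ vertexFinset n with p.1 = u.1 - (r : ℕ), edgeEnergy n w (0, 1) p
  set E₂ := ∑ p ∈ vertexFinset n with p.2 = u.2 - (r : ℕ), edgeEnergy n w (1, 0) p
  have hE₁0 : 0 ≤ E₁ := Finset.sum_nonneg fun p _ => edgeEnergy_nonneg n w _ p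
  have hE₂0 : 0 ≤ E₂ := Finset.sum_nonneg fun p _ => edgeEnergy_nonneg n w _ p
  obtain ⟨b, hbS, hB, hle⟩ := exists_boundary_le hpos w
    ((vertexFinset n).filter fun p => p.1 ≤ u.1 - r ∨ p.2 ≤ u.2 - r)
    (fun p => (p.1 = u.1 - r ∧ u.2 - r ≤ p.2) ∨ (p.2 = u.2 - r ∧ u.1 - r ≤ p.1) ∨
      p.1 + p.2 = (n : ℤ))
    (fun p hp => mem_vertexFinset.1 (Finset.mem_filter.1 hp).1)
    (fun p hp hB => by
      rw [Finset.mem_filter, mem_vertexFinset] at hp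
      rw [not_or, not_or] at hB
      refine ⟨hB.2.2, hharm p hp.1 hB.2.2, fun q hq hqV => ?_⟩
      rw [Finset.mem_filter, mem_vertexFinset]
      refine ⟨hqV, ?_⟩
      rw [mem_nbrs] at hq
      have := hp.1
      have := hp.2
      simp only [inV] at *
      omega)
    (p := (0, 0)) (by
      rw [Finset.mem_filter, mem_vertexFinset]
      simp only [inV] at *
      omega)
  rw [Finset.mem_filter, mem_vertexFinset] at hbS
  obtain ⟨hbV, hbd⟩ := hbS
  by_cases hbn : b.1 + b.2 = (n : ℤ)
  · have hbu : b ≠ u := by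
      rintro rfl
      simp at hbd
      omega
    rw [hside b hbV hbn hbu] at hle
    rw [le_antisymm hle hA]
    simp only [ne_eq, OfNat.ofNat_ne_zero, not_false_eq_true, zero_pow]
    positivity
  have hsq : w (0, 0) ^ 2 ≤ w b ^ 2 := pow_le_pow_left₀ hA hle 2
  have key : ∀ (v : ℤ × ℤ) (k : ℕ) (s : Finset (ℤ × ℤ)), v ≠ 0 → k ≤ 2 * r →
      (∀ i ≤ k, b + i • v ∈ s) → (∀ q ∈ s, inV n q) →
      (b + k • v).1 + (b + k • v).2 = (n : ℤ) → b + k • v ≠ u →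
      w b ^ 2 ≤ 2 * r * ∑ q ∈ s, edgeEnergy n w v q := by
    intro v k s hv hk hs hsV hend hendu
    have h := sq_sub_le_segment w hv b k s hs hsV
    rw [hside _ (hsV _ (hs k le_rfl)) hend hendu, sub_zero] at h
    refine h.trans (mul_le_mul_of_nonneg_right ?_
      (Finset.sum_nonneg fun p _ => edgeEnergy_nonneg n w _ p))
    exact_mod_cast hk
  simp only [inV] at hu hbV
  rcases hB with ⟨hb1, hb2⟩ | ⟨hb2, hb1⟩ | h
  · have h := key (0, 1) (u.2 + r - b.2).toNat
      ((vertexFinset n).filter fun p => p.1 = u.1 - (r : ℕ)) (by simp) (by omega)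
      (fun i hi => by
        simp only [Finset.mem_filter, mem_vertexFinset, inV, Prod.fst_add, Prod.snd_add,
          Prod.smul_mk, nsmul_eq_mul]
        omega)
      (fun q hq => mem_vertexFinset.1 (Finset.mem_filter.1 hq).1)
      (by
        simp only [Prod.fst_add, Prod.snd_add, Prod.smul_mk, nsmul_eq_mul]
        omega)
      (by
        simp only [ne_eq, Prod.ext_iff, Prod.fst_add, Prod.snd_add, Prod.smul_mk, nsmul_eq_mul]
        omega)
    have : 0 ≤ 2 * (r : ℝ) * E₂ := by positivity
    rw [mul_add]
    linarith
  · have h := key (1, 0) (u.1 + r - b.1).toNat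
      ((vertexFinset n).filter fun p => p.2 = u.2 - (r : ℕ)) (by simp) (by omega)
      (fun i hi => by
        simp only [Finset.mem_filter, mem_vertexFinset, inV, Prod.fst_add, Prod.snd_add,
          Prod.smul_mk, nsmul_eq_mul]
        omega)
      (fun q hq => mem_vertexFinset.1 (Finset.mem_filter.1 hq).1)
      (by
        simp only [Prod.fst_add, Prod.snd_add, Prod.smul_mk, nsmul_eq_mul]
        omega)
      (by
        simp only [ne_eq, Prod.ext_iff, Prod.fst_add, Prod.snd_add, Prod.smul_mk, nsmul_eq_mul]
        omega)
    have : 0 ≤ 2 * (r : ℝ) * E₁ := by positivity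
    rw [mul_add]
    linarith
  · exact absurd h hbn

lemma log_le_two_mul_harmonic {n : ℕ} (hn : 2 ≤ n) :
    Real.log n ≤ 2 * ∑ i ∈ Finset.range (n / 2), ((i + 1 : ℕ) : ℝ)⁻¹ := by
  have h := log_add_one_le_harmonic (n / 2)
  rw [Nat.cast_add_one] at h
  have hsq : n ≤ (n / 2 + 1) ^ 2 := by
    have : n ≤ 2 * (n / 2) + 1 := by omega
    nlinarith
  have hlog : Real.log n ≤ 2 * Real.log (((n / 2 : ℕ) : ℝ) + 1) := by
    have h2 := Real.log_pow (((n / 2 : ℕ) : ℝ) + 1) 2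
    rw [Nat.cast_ofNat] at h2
    rw [← h2]
    refine Real.log_le_log (by positivity) ?_
    exact_mod_cast hsq
  have hcast : ((harmonic (n / 2) : ℚ) : ℝ) =
      ∑ i ∈ Finset.range (n / 2), ((i + 1 : ℕ) : ℝ)⁻¹ := by
    simp [harmonic]
  rw [hcast] at h
  linarith

/-- The harmonic measure of a single vertex `u` of the side `i + j = n`, seen from the corner. -/
lemma harmonicMeasure_sq_mul_log_le {n : ℕ} (hn : 2 ≤ n) {M : ℝ} (hM : 0 < M)
    {η : ℤ × ℤ → ℤ × ℤ → ℝ} (hsymm : ∀ p q : ℤ × ℤ, η p q = η q p)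
    (hbound : ∀ p q : ℤ × ℤ, inV n p → inV n q → q ∈ nbrs p → 1 / M ≤ η p q ∧ η p q ≤ M)
    {w : ℤ × ℤ → ℝ} {u : ℤ × ℤ} (hu : inV n u) (hun : u.1 + u.2 = (n : ℤ)) (hwu : w u = 1)
    (hside : ∀ p, inV n p → p.1 + p.2 = (n : ℤ) → p ≠ u → w p = 0)
    (hharm : ∀ p, inV n p → p.1 + p.2 ≠ (n : ℤ) → lap n η w p = 0) :
    w (0, 0) ^ 2 * Real.log n ≤ 48 * M ^ 2 := by
  have hpos : ∀ p q, inV n p → inV n q → q ∈ nbrs p → 0 < η p q :=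
    fun p q hp hq hpq => (one_div_pos.2 hM).trans_le (hbound p q hp hq hpq).1
  have hw0 : ∀ p, inV n p → 0 ≤ w p := by
    intro p hp
    obtain ⟨b, hb, hbn, hle⟩ := exists_side_le hpos (-w)
      (fun p hp hpn => by rw [lap_neg, hharm p hp hpn, neg_zero]) hp
    have hb0 : 0 ≤ w b := by
      by_cases hbu : b = u
      · rw [hbu, hwu]; exact zero_le_one
      · rw [hside b hb hbn hbu]
    simp only [Pi.neg_apply] at hle
    linarith
  have hlapu : lap n η w u ≤ 6 * M := by
    have h1 : lap n η w u ≤ ∑ q ∈ (nbrs u).filter (fun q => inV n q), M := by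
      refine Finset.sum_le_sum fun q hq => ?_
      rw [Finset.mem_filter] at hq
      have h := mul_nonneg (hpos u q hu hq.2 hq.1).le (hw0 q hq.2)
      have h' := (hbound u q hu hq.2 hq.1).2
      rw [hwu]
      linarith
    rw [Finset.sum_const, nsmul_eq_mul] at h1
    refine h1.trans (mul_le_mul_of_nonneg_right ?_ hM.le)
    have : ((nbrs u).filter (fun q => inV n q)).card ≤ 6 :=
      (Finset.card_filter_le _ _).trans Finset.card_le_six
    exact_mod_cast this
  have henergy : dirichletForm n η w w ≤ 12 * M := by
    rw [dirichletForm_eq n η hsymm, Finset.sum_eq_single_of_mem u (mem_vertexFinset.2 hu), hwu]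
    · linarith
    · intro p hp hpu
      rw [mem_vertexFinset] at hp
      by_cases hpn : p.1 + p.2 = (n : ℤ)
      · rw [hside p hp hpn hpu, zero_mul]
      · rw [hharm p hp hpn, mul_zero]
  have hA : 0 ≤ w (0, 0) := hw0 _ (by simp [inV])
  have hsum : ∑ i ∈ Finset.range (n / 2), w (0, 0) ^ 2 / 2 * ((i + 1 : ℕ) : ℝ)⁻¹ ≤
      M * (12 * M) := by
    calc ∑ i ∈ Finset.range (n / 2), w (0, 0) ^ 2 / 2 * ((i + 1 : ℕ) : ℝ)⁻¹
        ≤ ∑ i ∈ Finset.range (n / 2),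
          (∑ p ∈ vertexFinset n with p.1 = u.1 - (i + 1 : ℕ), edgeEnergy n w (0, 1) p +
            ∑ p ∈ vertexFinset n with p.2 = u.2 - (i + 1 : ℕ), edgeEnergy n w (1, 0) p) := by
          refine Finset.sum_le_sum fun i hi => ?_
          have hi' := Finset.mem_range.1 hi
          have h := sq_corner_le hpos hu hun hside hharm hA (r := i + 1) (by omega) (by omega)
          rw [← div_eq_mul_inv, div_le_iff₀ (by positivity)]
          linarith
      _ ≤ ∑ p ∈ vertexFinset n, edgeEnergy n w (0, 1) p +
          ∑ p ∈ vertexFinset n, edgeEnergy n w (1, 0) p := by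
          rw [Finset.sum_add_distrib]
          exact add_le_add
            (sum_lines_le n _ _ (edgeEnergy_nonneg n w _) Prod.fst u.1)
            (sum_lines_le n _ _ (edgeEnergy_nonneg n w _) Prod.snd u.2)
      _ ≤ M * dirichletForm n η w w :=
          sum_edgeEnergy_le hM (fun p q hp hq hpq => (hbound p q hp hq hpq).1) w
      _ ≤ M * (12 * M) := mul_le_mul_of_nonneg_left henergy hM.le
  rw [← Finset.mul_sum] at hsum
  have hlog := mul_le_mul_of_nonneg_left (log_le_two_mul_harmonic hn) (sq_nonneg (w (0, 0)))
  linarith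

/-- (Lemma 5.7 / boundary Laplacian estimate.)  Let `η` be a symmetric conductance
with `1/M ≤ η ≤ M` on all edges, and `f` a function vanishing on the side
`V₀ = {i + j = n}` opposite the corner `A = (0,0)`, discrete-harmonic away from
`{A} ∪ V₀`, and with `(Δf)_A = 1`.  Then `|(Δf)_u| ≤ 20M/√(ln n)` for every `u ∈ V₀`. -/
theorem boundary_laplacian_estimate
    (n : ℕ) (hn : 2 ≤ n) (M : ℝ) (hM : 0 < M) (η : ℤ × ℤ → ℤ × ℤ → ℝ)
    (hsymm : ∀ p q : ℤ × ℤ, η p q = η q p)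
    (hbound : ∀ p q : ℤ × ℤ, inV n p → inV n q → q ∈ nbrs p →
      1 / M ≤ η p q ∧ η p q ≤ M)
    (f : ℤ × ℤ → ℝ)
    (hharm : ∀ p : ℤ × ℤ, inV n p → p ≠ (0, 0) → p.1 + p.2 ≠ (n : ℤ) →
      lap n η f p = 0)
    (hbdry : ∀ p : ℤ × ℤ, inV n p → p.1 + p.2 = (n : ℤ) → f p = 0)
    (hA : lap n η f (0, 0) = 1) :
    ∀ u : ℤ × ℤ, inV n u → u.1 + u.2 = (n : ℤ) →
      |lap n η f u| ≤ 20 * M / Real.sqrt (Real.log n) := by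
  intro u hu hun
  have hpos : ∀ p q, inV n p → inV n q → q ∈ nbrs p → 0 < η p q :=
    fun p q hp hq hpq => (one_div_pos.2 hM).trans_le (hbound p q hp hq hpq).1
  obtain ⟨w, hw, hwharm⟩ := exists_harmonic_extension hpos (fun p => if p = u then 1 else 0)
  have hwu : w u = 1 := by rw [hw u hu hun, if_pos rfl]
  have hside : ∀ p, inV n p → p.1 + p.2 = (n : ℤ) → p ≠ u → w p = 0 :=
    fun p hp hpn hpu => by rw [hw p hp hpn, if_neg hpu]
  have hAu : ((0, 0) : ℤ × ℤ) ≠ u := by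
    rintro rfl
    simp at hun
    omega
  have hAV : inV n (0, 0) := by simp [inV]
  have hreciprocity : w (0, 0) + lap n η f u = 0 := by
    have h := dirichletForm_comm n η w f
    rw [dirichletForm_eq n η hsymm, dirichletForm_eq n η hsymm,
      Finset.sum_eq_add_of_mem (0, 0) u (mem_vertexFinset.2 hAV) (mem_vertexFinset.2 hu) hAu,
      hA, hwu, Finset.sum_eq_zero (s := vertexFinset n) (f := fun p => f p * lap n η w p)] at h
    · linarith
    · intro p hp
      rw [mem_vertexFinset] at hp
      by_cases hpn : p.1 + p.2 = (n : ℤ)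
      · rw [hbdry p hp hpn, zero_mul]
      · rw [hwharm p hp hpn, mul_zero]
    · rintro p hp ⟨hpA, hpu⟩
      rw [mem_vertexFinset] at hp
      by_cases hpn : p.1 + p.2 = (n : ℤ)
      · rw [hside p hp hpn hpu, zero_mul]
      · rw [hharm p hp hpA hpn, mul_zero]
  have hlog : 0 < Real.log n := Real.log_pos (by exact_mod_cast hn)
  have hmain := harmonicMeasure_sq_mul_log_le hn hM hsymm hbound hu hun hwu hside hwharm
  rw [show lap n η f u = -w (0, 0) by linarith, abs_neg, le_div_iff₀ (Real.sqrt_pos.2 hlog)]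
  refine (sq_le_sq₀ (by positivity) (by positivity)).1 ?_
  rw [mul_pow, sq_abs, Real.sq_sqrt hlog.le]
  nlinarith [sq_nonneg M]
end
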